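/- Let T be a tree on n vertices. For each i ≤ n and k ≥ 1, let d_{i,k} = Σ_{λ⊢n, l(λ)=k+1} m_i(λ) c_λ(T), where m_i(λ) is the number of parts of λ equal to i. Then d_{i,k} = (−1)^{(i−1)+(n−i−k)} Σ_{j=1}^{k} C(n−i−j, k−j) f_T(i,j), where f_T(i,j) is the number of i-vertex subtrees H of T such that T − V(H) has exactly j components. -/

import Mathlib

open SimpleGraph

/-- Proper coloring for an edge set over `Sym2 V` (loops allowed): adjacent (or equal, for a
loop) endpoints must receive different colors. -/
def ProperCol {V : Type*} (E : Set (Sym2 V)) (k : V -> Nat) : Prop :=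
  forall u v : V, s(u, v) ∈ E -> k u ≠ k v

/-- Weighted chromatic symmetric function `X_{(G,w)}` as a formal power series in the
variables `x_0, x_1, …` : the coefficient of a monomial `d` is the number of proper
colorings whose total weight in color `i` is `d i` for every `i`. -/
noncomputable def csfW {V : Type*} (E : Set (Sym2 V)) (w : V -> Nat) : MvPowerSeries Nat Int :=
  fun d => (Nat.card {k : V -> Nat |
    ProperCol E k ∧ forall i : Nat, (∑ᶠ v ∈ {v : V | k v = i}, w v) = d i} : Int)

/-- Chromatic symmetric function `X_G` of a simple graph. -/
noncomputable def csf {V : Type*} (G : SimpleGraph V) : MvPowerSeries Nat Int :=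
  csfW G.edgeSet (fun _ => 1)

/-- The power-sum symmetric function `p_k = Σ_i x_i ^ k`. -/
noncomputable def psum (k : Nat) : MvPowerSeries Nat Int :=
  open scoped Classical in
  fun d => if ∃ i : Nat, d = Finsupp.single i k then 1 else 0

/-- `p_lam` for a multiset of parts `lam`. -/
noncomputable def pProd (m : Multiset Nat) : MvPowerSeries Nat Int :=
  (m.map psum).prod

/-- `fT T i j` : the number of `i`-vertex subtrees `H` of `T` (connected induced subgraphs)
such that `T - V(H)` has exactly `j` connected components. -/
noncomputable def fT {V : Type*} [Finite V] (T : SimpleGraph V) (i j : Nat) : Nat :=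
  Nat.card {W : Set V | W.ncard = i ∧ (T.induce W).Connected ∧
    Nat.card (T.induce Wᶜ).ConnectedComponent = j}

/-- The total weight in each color of a coloring `k` of the weighted set `(ι, w)`. -/
noncomputable def colorContent {ι : Type*} [Fintype ι] (w k : ι → ℕ) : ℕ →₀ ℕ :=
  ∑ a, Finsupp.single (k a) (w a)

lemma colorContent_eq_iff {ι : Type*} [Fintype ι] (w k : ι → ℕ) (d : ℕ →₀ ℕ) :
    colorContent w k = d ↔ ∀ i : ℕ, (∑ᶠ v ∈ {v : ι | k v = i}, w v) = d i := by
  classical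
  rw [DFunLike.ext_iff]
  refine forall_congr' fun i => ?_
  rw [finsum_mem_eq_sum_filter _ _ (Set.toFinite _)]
  simp only [colorContent, Finsupp.finsetSum_apply, Finsupp.single_apply]
  rw [← Finset.sum_filter]
  have : Finset.univ.filter (fun a => k a = i) =
      (Set.toFinite (Function.support w)).toFinset.filter (fun v => v ∈ {v : ι | k v = i}) ∪
      Finset.univ.filter (fun a => k a = i ∧ w a = 0) := by
    ext a; by_cases h : w a = 0 <;> simp [h]
  rw [this, Finset.sum_union]
  · rw [Finset.sum_eq_zero (s := Finset.univ.filter (fun a => k a = i ∧ w a = 0)), add_zero]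
    intro x hx; exact (Finset.mem_filter.1 hx).2.2
  · rw [Finset.disjoint_left]; intro a; simp; tauto

lemma finite_colorContent_eq {ι : Type*} [Fintype ι] {w : ι → ℕ} (hw : ∀ a, 0 < w a)
    (d : ℕ →₀ ℕ) : {k : ι → ℕ | colorContent w k = d}.Finite := by
  refine (Set.Finite.pi' (t := fun _ => (d.support : Set ℕ))
    fun _ => d.support.finite_toSet).subset ?_
  rintro k rfl a
  have h : Finsupp.single (k a) (w a) ≤ colorContent w k :=
    Finset.single_le_sum (f := fun a => Finsupp.single (k a) (w a)) (fun _ _ => zero_le)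
      (Finset.mem_univ a)
  have := h (k a)
  have := hw a
  simp at *
  omega

lemma coeff_prod_psum {ι : Type*} [Fintype ι] {w : ι → ℕ} (hw : ∀ a, 0 < w a) (d : ℕ →₀ ℕ) :
    MvPowerSeries.coeff d (∏ a, psum (w a)) = Nat.card {k : ι → ℕ | colorContent w k = d} := by
  classical
  have hc : ∀ (e : ℕ →₀ ℕ) m, MvPowerSeries.coeff e (psum m) =
      if ∃ i : ℕ, e = Finsupp.single i m then 1 else 0 := by
    intro e m; simp only [MvPowerSeries.coeff_apply, psum]
  rw [MvPowerSeries.coeff_prod]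
  simp only [hc, Finset.prod_ite_zero, Finset.prod_const_one, Finset.sum_boole]
  rw [Nat.card_coe_set_eq, Set.ncard_eq_toFinset_card _ (finite_colorContent_eq hw d)]
  congr 1
  symm
  refine Finset.card_bij
    (fun k _ => Finsupp.equivFunOnFinite.symm (fun a => Finsupp.single (k a) (w a))) ?_ ?_ ?_
  · intro k hk
    simp only [Set.Finite.mem_toFinset, Set.mem_ofPred_eq] at hk
    simp only [Finset.mem_filter, Finset.mem_finsuppAntidiag]
    refine ⟨⟨by simpa [colorContent] using hk, by simp⟩, fun a _ => ⟨k a, by simp⟩⟩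
  · intro k _ k' _ h
    have h := Finsupp.equivFunOnFinite.symm.injective h
    funext a
    exact Finsupp.single_left_injective (hw a).ne' (congrFun h a)
  · intro l hl
    simp only [Finset.mem_filter, Finset.mem_finsuppAntidiag, Finset.mem_univ, true_implies] at hl
    obtain ⟨⟨h1, -⟩, h2⟩ := hl
    choose k hk using h2
    refine ⟨k, ?_, ?_⟩
    · simp [colorContent, ← hk, h1]
    · ext a : 1
      simp [hk]

open Classical in
lemma ite_forall_not_eq_sum {α : Type*} (s : Finset α) (p : α → Prop) :
    (if ∀ e ∈ s, ¬ p e then (1 : ℤ) else 0) =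
      ∑ S ∈ s.powerset, (-1 : ℤ) ^ S.card * if ∀ e ∈ S, p e then 1 else 0 := by
  have h : (if ∀ e ∈ s, ¬ p e then (1 : ℤ) else 0) = ∏ e ∈ s, (1 - if p e then (1 : ℤ) else 0) := by
    rw [← Finset.prod_boole]
    exact Finset.prod_congr rfl fun e _ => by split_ifs <;> rfl
  rw [h, Finset.prod_sub]
  refine Finset.sum_congr rfl fun S _ => ?_
  rw [Finset.prod_const_one, mul_one, Finset.prod_boole]

/-- Expansion of the number of proper colorings with given content by inclusion-exclusion. -/
lemma csf_apply {V : Type*} [Fintype V] (T : SimpleGraph V) [DecidableEq V] [Fintype T.edgeSet]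
    (d : ℕ →₀ ℕ) :
    csf T d = ∑ S ∈ T.edgeFinset.powerset, (-1 : ℤ) ^ S.card *
      Nat.card {k : V → ℕ | colorContent (fun _ => 1) k = d ∧ ∀ e ∈ S, (e.map k).IsDiag} := by
  classical
  have hfin := finite_colorContent_eq (w := fun _ : V => 1) (fun _ => one_pos) d
  have key : ∀ P : (V → ℕ) → Prop,
      (Nat.card {k : V → ℕ | colorContent (fun _ => 1) k = d ∧ P k} : ℤ) =
        ∑ k ∈ hfin.toFinset, if P k then 1 else 0 := by
    intro P
    rw [Finset.sum_boole, Nat.card_coe_set_eq, ← Set.ncard_coe_finset]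
    congr 2
    ext k; simp
  have h0 : csf T d = (Nat.card {k : V → ℕ | colorContent (fun _ => 1) k = d ∧
      ∀ e ∈ T.edgeFinset, ¬ (e.map k).IsDiag} : ℤ) := by
    simp only [csf, csfW]
    congr 4
    ext k
    rw [← colorContent_eq_iff, and_comm]
    refine and_congr_right fun _ => ?_
    simp only [ProperCol, Sym2.forall, mem_edgeFinset, Sym2.map_mk, Sym2.mk_isDiag_iff]
  rw [h0, key]
  simp only [key, Finset.mul_sum]
  rw [Finset.sum_comm]
  refine Finset.sum_congr rfl fun k _ => ?_
  convert ite_forall_not_eq_sum T.edgeFinset fun e => (e.map k).IsDiag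

/-- The partition of the number of vertices given by the sizes of the connected components. -/
noncomputable def componentPartition {V : Type*} [Fintype V] (G : SimpleGraph V)
    [Fintype G.ConnectedComponent] : (Fintype.card V).Partition where
  parts := Finset.univ.val.map fun C : G.ConnectedComponent => C.supp.ncard
  parts_pos := by
    intro i hi
    obtain ⟨C, -, rfl⟩ := Multiset.mem_map.1 hi
    exact (Set.ncard_pos (Set.toFinite _)).2 C.nonempty_supp
  parts_sum := by
    classical
    change ∑ C : G.ConnectedComponent, C.supp.ncard = _
    rw [← Finset.card_univ, Finset.card_eq_sum_card_fiberwise (f := G.connectedComponentMk)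
      (t := Finset.univ) (fun _ _ => by simp)]
    refine Finset.sum_congr rfl fun C _ => ?_
    rw [← Set.ncard_coe_finset]
    congr 1
    ext v
    simp

/-- Colorings constant on connected components are colorings of the set of components. -/
lemma card_coloring_constant_on_components {V : Type*} [Fintype V] (G : SimpleGraph V)
    [Fintype G.ConnectedComponent] (d : ℕ →₀ ℕ) :
    Nat.card {k : V → ℕ | colorContent (fun _ => 1) k = d ∧ ∀ u v, G.Adj u v → k u = k v} =
      Nat.card {k : G.ConnectedComponent → ℕ |
        colorContent (fun C => C.supp.ncard) k = d} := by
  classical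
  have hcont : ∀ k : G.ConnectedComponent → ℕ,
      colorContent (fun _ => 1) (fun v => k (G.connectedComponentMk v)) =
        colorContent (fun C => C.supp.ncard) k := by
    intro k
    unfold colorContent
    rw [← Finset.sum_fiberwise_of_maps_to (s := Finset.univ) (t := Finset.univ)
      (g := G.connectedComponentMk) (fun _ _ => Finset.mem_univ _)]
    refine Finset.sum_congr rfl fun C _ => ?_
    have : C.supp.ncard = (Finset.univ.filter fun v => G.connectedComponentMk v = C).card := by
      rw [← Set.ncard_coe_finset]
      congr 1
      ext v
      simp
    beta_reduce
    rw [this, Finset.sum_congr rfl (g := fun _ => Finsupp.single (k C) 1), Finset.sum_const,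
      Finsupp.smul_single, smul_eq_mul, mul_one]
    intro v hv
    rw [(Finset.mem_filter.1 hv).2]
  symm
  refine Nat.card_congr (Equiv.ofBijective
    (fun k => ⟨fun v => k.1 (G.connectedComponentMk v), ?_, ?_⟩) ⟨?_, ?_⟩)
  · exact (hcont _).trans k.2
  · intro u v huv
    exact congrArg _ (ConnectedComponent.sound huv.reachable)
  · rintro ⟨k, hk⟩ ⟨k', hk'⟩ h
    ext C
    induction C using ConnectedComponent.ind with | _ v
    exact congrFun (congrArg Subtype.val h) v
  · rintro ⟨k, hk, hadj⟩
    have hreach : ∀ u v (p : G.Walk u v), p.IsPath → k u = k v := by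
      intro u v p _
      induction p with
      | nil => rfl
      | cons h p ih => exact (hadj _ _ h).trans (ih (by simp_all))
    refine ⟨⟨fun C => C.lift k hreach, ?_⟩, ?_⟩
    · change colorContent _ _ = d
      rw [← hcont]
      exact hk
    · rfl

open Classical in
lemma csf_eq_sum_pProd {V : Type*} [Fintype V] (T : SimpleGraph V) :
    csf T = ∑ S ∈ T.edgeFinset.powerset, (-1 : ℤ) ^ S.card •
      pProd (componentPartition (fromEdgeSet (S : Set (Sym2 V)))).parts := by
  ext d
  rw [map_sum, MvPowerSeries.coeff_apply, csf_apply]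
  refine Finset.sum_congr rfl fun S _ => ?_
  have hS : ∀ k : V → ℕ, (∀ e ∈ S, (e.map k).IsDiag) ↔
      ∀ u v, (fromEdgeSet (S : Set (Sym2 V))).Adj u v → k u = k v := by
    intro k
    simp only [Sym2.forall, Sym2.map_mk, Sym2.mk_isDiag_iff, fromEdgeSet_adj, Finset.mem_coe]
    refine forall₂_congr fun u v => ⟨fun h h' => h h'.1, fun h h' => ?_⟩
    by_cases huv : u = v
    · rw [huv]
    · exact h ⟨h', huv⟩
  simp only [hS]
  rw [card_coloring_constant_on_components, ← coeff_prod_psum, map_zsmul, smul_eq_mul]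
  · rw [pProd, componentPartition, Multiset.map_map]
    rfl
  · exact fun C => (Set.ncard_pos (Set.toFinite _)).2 C.nonempty_supp

lemma support_colorContent {ι : Type*} [Fintype ι] {w : ι → ℕ} (hw : ∀ a, 0 < w a) (k : ι → ℕ) :
    (colorContent w k).support = Finset.univ.image k := by
  classical
  ext i
  simp only [colorContent, Finsupp.mem_support_iff, Finsupp.finsetSum_apply, ne_eq,
    Finset.sum_eq_zero_iff, Finsupp.single_apply, Finset.mem_image, Finset.mem_univ, true_and,
    true_implies]
  push Not
  refine exists_congr fun a => ?_
  have := (hw a).ne'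
  simp [this]

lemma map_support_colorContent {ι : Type*} [Fintype ι] {w : ι → ℕ} (hw : ∀ a, 0 < w a)
    {k : ι → ℕ} (hk : Function.Injective k) :
    (colorContent w k).support.val.map (colorContent w k) = Finset.univ.val.map w := by
  classical
  rw [support_colorContent hw, Finset.image_val_of_injOn hk.injOn, Multiset.map_map]
  refine Multiset.map_congr rfl fun a _ => ?_
  simp [colorContent, Finsupp.single_apply, hk.eq_iff]

lemma coeff_pProd {m : Multiset ℕ} (hm : ∀ i ∈ m, 0 < i) (d : ℕ →₀ ℕ) :
    MvPowerSeries.coeff d (pProd m) =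
      Nat.card {k : m → ℕ | colorContent (fun a : m => (a : ℕ)) k = d} := by
  rw [← coeff_prod_psum (fun a : m => hm _ (Multiset.coe_mem))]
  conv_lhs => rw [pProd, ← Multiset.map_univ_coe m, Multiset.map_map]
  rfl

/-- The power sum products `p_λ` are linearly independent. -/
lemma pProd_linearIndependent {n : ℕ} (c : n.Partition → ℤ)
    (h : ∑ lam : n.Partition, c lam • pProd lam.parts = 0) : c = 0 := by
  classical
  by_contra hc
  obtain ⟨lam₀, hlam₀⟩ := Function.ne_iff.1 hc
  obtain ⟨lam, hlam, hmax⟩ := Finset.exists_max_image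
    (Finset.univ.filter fun lam : n.Partition => c lam ≠ 0) (fun lam => lam.parts.card)
    ⟨lam₀, by simpa using hlam₀⟩
  simp only [Finset.mem_filter, Finset.mem_univ, true_and] at hlam hmax
  have hpos : ∀ (mu : n.Partition) (a : mu.parts), 0 < (a : ℕ) :=
    fun mu a => mu.parts_pos Multiset.coe_mem
  let e : lam.parts → ℕ := fun a => Fintype.equivFin _ a
  have he : Function.Injective e := Fin.val_injective.comp (Equiv.injective _)
  let d := colorContent (fun a : lam.parts => (a : ℕ)) e
  have h1 := congrArg (MvPowerSeries.coeff d) h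
  rw [map_sum, map_zero, Finset.sum_eq_single lam, map_zsmul, smul_eq_mul,
    coeff_pProd fun i hi => lam.parts_pos hi] at h1
  · have h2 := (mul_eq_zero.1 h1).resolve_left hlam
    have := (finite_colorContent_eq (hpos lam) d).to_subtype
    have : Nonempty {k : lam.parts → ℕ | colorContent (fun a : lam.parts => (a : ℕ)) k = d} :=
      ⟨⟨e, rfl⟩⟩
    exact Nat.card_pos.ne' (Int.natCast_eq_zero.1 h2)
  · intro mu _ hmu
    rw [map_zsmul, smul_eq_mul, mul_eq_zero, or_iff_not_imp_left]
    intro hcmu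
    rw [coeff_pProd fun i hi => mu.parts_pos hi, Int.natCast_eq_zero]
    by_contra hne
    obtain ⟨⟨k, hk⟩⟩ := (Nat.card_ne_zero.1 hne).1
    replace hk : colorContent (fun a : mu.parts => (a : ℕ)) k = d := hk
    have hsupp : Finset.univ.image k = Finset.univ.image e := by
      rw [← support_colorContent (hpos mu), ← support_colorContent (hpos lam), hk]
    have hinj : Function.Injective k := by
      rw [← Set.injOn_univ, ← Finset.coe_univ, ← Finset.card_image_iff]
      refine le_antisymm Finset.card_image_le ?_
      rw [hsupp, Finset.card_image_of_injective _ he, Finset.card_univ, Finset.card_univ,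
        Multiset.card_coe, Multiset.card_coe]
      exact hmax mu hcmu
    refine hmu (Nat.Partition.ext ?_)
    have hmap := map_support_colorContent (hpos mu) hinj
    rw [hk, map_support_colorContent (hpos lam) he] at hmap
    exact ((Multiset.map_univ_coe _).symm.trans hmap.symm).trans (Multiset.map_univ_coe _)
  · simp

lemma card_filter_edgeFinset_subset {V : Type*} [Fintype V] [DecidableEq V] (G : SimpleGraph V)
    [Fintype G.edgeSet] (W : Set V) [Fintype (G.induce W).edgeSet]
    [DecidablePred fun e : Sym2 V => ∀ v ∈ e, v ∈ W] :
    (G.edgeFinset.filter fun e => ∀ v ∈ e, v ∈ W).card = (G.induce W).edgeFinset.card := by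
  classical
  rw [← Finset.card_map (Function.Embedding.subtype (· ∈ W)).sym2Map]
  congr 1
  ext e
  have h := Finset.ext_iff.1 (map_edgeFinset_induce (G := G) (s := W)) e
  simp only [Finset.mem_map, mem_edgeFinset, Finset.mem_inter, Finset.mem_sym2_iff,
    Set.mem_toFinset, Finset.mem_filter] at h ⊢
  exact h.symm

lemma SimpleGraph.IsAcyclic.card_edgeFinset_add_card_connectedComponent {V : Type*} [Fintype V]
    {G : SimpleGraph V} [Fintype G.edgeSet] (hG : G.IsAcyclic) :
    G.edgeFinset.card + Nat.card G.ConnectedComponent = Fintype.card V := by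
  classical
  have hE : G.edgeFinset.card = ∑ C : G.ConnectedComponent,
      (G.edgeFinset.filter fun e => ∀ v ∈ e, v ∈ C.supp).card := by
    rw [← Finset.card_biUnion]
    · congr 1
      ext e
      induction e with | _ u v
      simp only [mem_edgeFinset, mem_edgeSet, Finset.mem_biUnion, Finset.mem_filter]
      refine ⟨fun h => ⟨G.connectedComponentMk u, Finset.mem_univ _, h, ?_⟩, fun ⟨_, _, h, _⟩ => h⟩
      simpa using h.reachable.symm
    · intro C _ D _ hCD
      rw [Function.onFun, Finset.disjoint_left]
      intro e heC heD
      induction e with | _ u v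
      exact hCD (ConnectedComponent.eq_of_common_vertex ((Finset.mem_filter.1 heC).2 u (by simp))
        ((Finset.mem_filter.1 heD).2 u (by simp)))
  have hV : Fintype.card V = ∑ C : G.ConnectedComponent, Fintype.card C.supp := by
    rw [← Finset.card_univ, Finset.card_eq_sum_card_fiberwise (f := G.connectedComponentMk)
      (t := Finset.univ) (fun _ _ => by simp)]
    refine Finset.sum_congr rfl fun C _ => ?_
    rw [← Set.toFinset_card]
    congr 1
    ext v
    simp
  rw [hE, hV, Nat.card_eq_fintype_card, ← Finset.card_univ, Finset.card_eq_sum_ones,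
    ← Finset.sum_add_distrib]
  refine Finset.sum_congr rfl fun C _ => ?_
  rw [card_filter_edgeFinset_subset]
  have hC : (G.induce C.supp).IsTree := hG.isTree_connectedComponent C
  exact hC.card_edgeFinset

/-- In an acyclic graph, a spanning subgraph has a given connected vertex set `W` as a component
if and only if, of the edges meeting `W`, it contains precisely those inside `W`. -/
lemma exists_supp_eq_iff {V : Type*} {T : SimpleGraph V} (hT : T.IsAcyclic)
    {S : Set (Sym2 V)} (hS : S ⊆ T.edgeSet) {W : Set V} (hW : (T.induce W).Connected) :
    (∃ C : (fromEdgeSet S).ConnectedComponent, C.supp = W) ↔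
      ∀ e ∈ T.edgeSet, (∃ v ∈ e, v ∈ W) → (e ∈ S ↔ ∀ v ∈ e, v ∈ W) := by
  constructor
  · rintro ⟨C, rfl⟩ e he ⟨x, hxe, hx⟩
    obtain ⟨y, rfl⟩ := hxe
    have hxy : T.Adj x y := he
    simp only [Sym2.mem_iff, forall_eq_or_imp, forall_eq]
    refine ⟨fun h => ⟨hx, C.mem_supp_of_adj_mem_supp hx ((fromEdgeSet_adj _).2 ⟨h, hxy.ne⟩)⟩,
      fun ⟨_, hy⟩ => ?_⟩
    by_contra hnot
    have hb := isAcyclic_iff_forall_adj_isBridge.1 hT hxy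
    refine isBridge_iff.1 hb ((C.reachable_of_mem_supp hx hy).mono ?_)
    intro a b hab
    rw [fromEdgeSet_adj] at hab
    rw [deleteEdges_adj]
    refine ⟨hS hab.1, fun h => hnot ?_⟩
    rw [← Set.mem_singleton_iff.1 h]
    exact hab.1
  · intro h
    obtain ⟨w, hw⟩ := hW.nonempty
    have hle : ∀ a b : W, T.Adj a b → (fromEdgeSet S).Adj a b := fun a b hab =>
      (fromEdgeSet_adj _).2 ⟨(h _ hab ⟨a, by simp, a.2⟩).2 (by simp), hab.ne⟩
    refine ⟨(fromEdgeSet S).connectedComponentMk w, Set.Subset.antisymm ?_ ?_⟩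
    · intro v hv
      obtain ⟨p⟩ := (ConnectedComponent.exact hv).symm
      clear hv
      induction p with
      | nil => exact hw
      | @cons a b c hab p ih =>
        have hab := ((fromEdgeSet_adj _).1 hab).1
        exact ih (((h _ (hS hab) ⟨a, by simp, hw⟩).1 hab) b (by simp))
    · intro v hv
      let f : T.induce W →g fromEdgeSet S := ⟨Subtype.val, fun {a b} hab => hle a b hab⟩
      exact ConnectedComponent.sound ((hW.preconnected ⟨v, hv⟩ ⟨w, hw⟩).map f)

/-- Subsets of `E` of a given size whose elements satisfying `q` are those satisfying `p`. -/
lemma card_filter_powerset_prescribed {α : Type*} [DecidableEq α] (E : Finset α)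
    (p q : α → Prop) [DecidablePred p] [DecidablePred q] (hpq : ∀ e ∈ E, p e → q e) (m : ℕ)
    [DecidablePred fun S : Finset α =>
      S.card = (E.filter p).card + m ∧ ∀ e ∈ E, q e → (e ∈ S ↔ p e)] :
    (E.powerset.filter fun S =>
      S.card = (E.filter p).card + m ∧ ∀ e ∈ E, q e → (e ∈ S ↔ p e)).card =
      (E.filter fun e => ¬ q e).card.choose m := by
  rw [← Finset.card_powersetCard]
  have hdisj : ∀ B ⊆ E.filter (fun e => ¬ q e), Disjoint (E.filter p) B := by
    intro B hB
    rw [Finset.disjoint_left]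
    intro e he heB
    have := Finset.mem_filter.1 he
    exact (Finset.mem_filter.1 (hB heB)).2 (hpq e this.1 this.2)
  have hunion : ∀ S ⊆ E, (∀ e ∈ E, q e → (e ∈ S ↔ p e)) →
      E.filter p ∪ S.filter (fun e => ¬ q e) = S := by
    intro S hS h
    ext e
    have := @hS e
    have := h e
    have := hpq e
    simp only [Finset.mem_union, Finset.mem_filter]
    tauto
  have hsub : ∀ S ⊆ E, S.filter (fun e => ¬ q e) ⊆ E.filter (fun e => ¬ q e) :=
    fun S hS => Finset.filter_subset_filter _ hS
  symm
  refine Finset.card_bij' (fun B _ => E.filter p ∪ B) (fun S _ => S.filter fun e => ¬ q e)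
    ?_ ?_ ?_ ?_
  · intro B hB
    obtain ⟨hB, hcard⟩ := Finset.mem_powersetCard.1 hB
    rw [Finset.mem_filter, Finset.mem_powerset, Finset.card_union_of_disjoint (hdisj B hB), hcard]
    refine ⟨Finset.union_subset (Finset.filter_subset _ _)
      (hB.trans (Finset.filter_subset _ _)), rfl, fun e he hq => ?_⟩
    have := @hB e
    simp only [Finset.mem_union, Finset.mem_filter] at this ⊢
    tauto
  · intro S hS
    obtain ⟨hS, hcard, h⟩ := Finset.mem_filter.1 hS
    rw [Finset.mem_powerset] at hS
    rw [Finset.mem_powersetCard]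
    refine ⟨hsub S hS, ?_⟩
    have := congrArg Finset.card (hunion S hS h)
    rw [Finset.card_union_of_disjoint (hdisj _ (hsub S hS)), hcard] at this
    exact Nat.add_left_cancel this
  · intro B hB
    obtain ⟨hB, -⟩ := Finset.mem_powersetCard.1 hB
    ext e
    have := @hB e
    have := hpq e
    simp only [Finset.mem_union, Finset.mem_filter] at *
    tauto
  · intro S hS
    obtain ⟨hS, -, h⟩ := Finset.mem_filter.1 hS
    exact hunion S (Finset.mem_powerset.1 hS) h

open Classical in
/-- Signed count of the spanning subgraphs with `k + 1` components, one of which is `W`. -/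
lemma sum_sign_of_component {V : Type*} [Fintype V] {T : SimpleGraph V} (hT : T.IsAcyclic)
    {W : Set V} (hW : (T.induce W).Connected) {k : ℕ} (hk : 1 ≤ k) :
    ∑ S ∈ T.edgeFinset.powerset.filter fun S : Finset (Sym2 V) => S.card + (k + 1) = Fintype.card V ∧
      ∃ C : (fromEdgeSet (S : Set (Sym2 V))).ConnectedComponent, C.supp = W,
      (-1 : ℤ) ^ S.card =
    (-1 : ℤ) ^ ((W.ncard - 1) + (Fintype.card V - W.ncard - k)) *
      ∑ j ∈ Finset.Icc 1 k, ((Fintype.card V - W.ncard - j).choose (k - j) : ℤ) *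
        if Nat.card (T.induce Wᶜ).ConnectedComponent = j then 1 else 0 := by
  have hWle : W.ncard + (Wᶜ).ncard = Fintype.card V := by
    rw [Set.ncard_add_ncard_compl, Nat.card_eq_fintype_card]
  have hin : (T.edgeFinset.filter fun e => ∀ v ∈ e, v ∈ W).card + 1 = W.ncard := by
    rw [card_filter_edgeFinset_subset, ← Nat.card_coe_set_eq, Nat.card_eq_fintype_card]
    exact (IsTree.mk hW (hT.induce W)).card_edgeFinset
  have hout : (T.edgeFinset.filter fun e => ¬ ∃ v ∈ e, v ∈ W).card +
      Nat.card (T.induce Wᶜ).ConnectedComponent = (Wᶜ).ncard := by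
    rw [← Nat.card_coe_set_eq Wᶜ, Nat.card_eq_fintype_card (α := ↥Wᶜ),
      ← (hT.induce Wᶜ).card_edgeFinset_add_card_connectedComponent,
      ← card_filter_edgeFinset_subset]
    simp
  have hcomp : (Wᶜ).ncard ≠ 0 → 1 ≤ Nat.card (T.induce Wᶜ).ConnectedComponent := by
    intro h
    have := (Set.nonempty_of_ncard_ne_zero h).to_subtype
    exact Nat.card_pos
  simp only [mul_ite, mul_one, mul_zero, Finset.sum_ite_eq, Finset.mem_Icc]
  set a := (T.edgeFinset.filter fun e => ∀ v ∈ e, v ∈ W).card with ha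
  set b := (T.edgeFinset.filter fun e => ¬ ∃ v ∈ e, v ∈ W).card with hb
  set r := Nat.card (T.induce Wᶜ).ConnectedComponent
  have hchar : ∀ S ∈ T.edgeFinset.powerset,
      (∃ C : (fromEdgeSet (S : Set (Sym2 V))).ConnectedComponent, C.supp = W) ↔
      ∀ e ∈ T.edgeFinset, (∃ v ∈ e, v ∈ W) → (e ∈ S ↔ ∀ v ∈ e, v ∈ W) := by
    intro S hS
    rw [exists_supp_eq_iff hT _ hW]
    · simp
    · intro e he
      exact mem_edgeFinset.1 (Finset.mem_powerset.1 hS he)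
  by_cases hle : k ≤ (Wᶜ).ncard
  · have hfilter : T.edgeFinset.powerset.filter (fun S : Finset (Sym2 V) => S.card + (k + 1) = Fintype.card V ∧
        ∃ C : (fromEdgeSet (S : Set (Sym2 V))).ConnectedComponent, C.supp = W) =
        T.edgeFinset.powerset.filter fun S => S.card = a + ((Wᶜ).ncard - k) ∧
          ∀ e ∈ T.edgeFinset, (∃ v ∈ e, v ∈ W) → (e ∈ S ↔ ∀ v ∈ e, v ∈ W) := by
      refine Finset.filter_congr fun S hS => and_congr ?_ (hchar S hS)
      omega
    rw [Finset.sum_congr hfilter (g := fun _ => (-1 : ℤ) ^ (a + ((Wᶜ).ncard - k)))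
      fun S hS => by rw [(Finset.mem_filter.1 hS).2.1], Finset.sum_const, ha,
      card_filter_powerset_prescribed _ _ _ _ _, ← ha, ← hb, nsmul_eq_mul, mul_comm]
    · have h1 : W.ncard - 1 + (Fintype.card V - W.ncard - k) = a + ((Wᶜ).ncard - k) := by omega
      rw [h1]
      split_ifs with h
      · have h2 : Fintype.card V - W.ncard - r = b := by omega
        have h3 : b.choose ((Wᶜ).ncard - k) = b.choose (k - r) :=
          Nat.choose_symm_of_eq_add (by omega)
        rw [h2, h3]
      · rw [Nat.choose_eq_zero_of_lt (by omega), Nat.cast_zero, mul_zero]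
    · intro e _ he
      exact ⟨_, e.out_fst_mem, he _ e.out_fst_mem⟩
  · rw [Finset.sum_eq_zero]
    · symm
      split_ifs with h
      · rw [Nat.choose_eq_zero_of_lt (by omega), Nat.cast_zero, mul_zero]
      · rfl
    · intro S hS
      obtain ⟨hS, hcard, hC⟩ := Finset.mem_filter.1 hS
      have hsub : (T.edgeFinset.filter fun e => ∀ v ∈ e, v ∈ W) ⊆ S := by
        intro e he
        obtain ⟨he, heW⟩ := Finset.mem_filter.1 he
        exact ((hchar S hS).1 hC e he ⟨_, e.out_fst_mem, heW _ e.out_fst_mem⟩).2 heW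
      have := Finset.card_le_card hsub
      omega

open Classical in
lemma count_componentPartition {V : Type*} [Fintype V] {T : SimpleGraph V} {S : Finset (Sym2 V)}
    (hS : S ∈ T.edgeFinset.powerset) (i : ℕ) :
    (componentPartition (fromEdgeSet (S : Set (Sym2 V)))).parts.count i =
      ∑ W : Set V with W.ncard = i ∧ (T.induce W).Connected,
        if ∃ C : (fromEdgeSet (S : Set (Sym2 V))).ConnectedComponent, C.supp = W then 1 else 0 := by
  rw [Finset.sum_boole, Finset.filter_filter, componentPartition, Multiset.count_map,
    ← Finset.filter_val, Finset.card_val, Nat.cast_id,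
    ← Finset.card_image_of_injective _ ConnectedComponent.supp_injective]
  congr 1
  ext W
  simp only [Finset.mem_image, Finset.mem_filter, Finset.mem_univ, true_and]
  constructor
  · rintro ⟨C, rfl, rfl⟩
    refine ⟨⟨rfl, C.maximal_connected_induce_supp.prop.mono fun a b hab => ?_⟩, C, rfl⟩
    exact mem_edgeFinset.1 (Finset.mem_powerset.1 hS ((fromEdgeSet_adj _).1 hab).1)
  · rintro ⟨⟨rfl, -⟩, C, rfl⟩
    exact ⟨C, rfl, rfl⟩

open Classical in
lemma card_parts_componentPartition {V : Type*} [Fintype V] {T : SimpleGraph V}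
    (hT : T.IsAcyclic) {S : Finset (Sym2 V)} (hS : S ∈ T.edgeFinset.powerset) :
    S.card + (componentPartition (fromEdgeSet (S : Set (Sym2 V)))).parts.card =
      Fintype.card V := by
  have hS' : ∀ e ∈ S, e ∈ T.edgeSet := fun e he => mem_edgeFinset.1 (Finset.mem_powerset.1 hS he)
  have hle : fromEdgeSet (S : Set (Sym2 V)) ≤ T := fun a b hab =>
    hS' _ ((fromEdgeSet_adj _).1 hab).1
  refine Eq.trans ?_ (hT.anti hle).card_edgeFinset_add_card_connectedComponent
  rw [componentPartition, Multiset.card_map, Finset.card_val, Finset.card_univ,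
    Nat.card_eq_fintype_card]
  congr 2
  ext e
  rw [mem_edgeFinset, edgeSet_fromEdgeSet]
  exact ⟨fun h => ⟨h, T.not_isDiag_of_mem_edgeSet (hS' e h)⟩, fun h => h.1⟩

open Classical in
lemma coeff_eq_sum_of_csf_eq {V : Type*} [Fintype V] (T : SimpleGraph V)
    (c : (Fintype.card V).Partition → ℤ)
    (hX : csf T = ∑ᶠ lam : (Fintype.card V).Partition, c lam • pProd lam.parts)
    (lam : (Fintype.card V).Partition) :
    c lam = ∑ S ∈ T.edgeFinset.powerset,
      if componentPartition (fromEdgeSet (S : Set (Sym2 V))) = lam then (-1 : ℤ) ^ S.card else 0 := by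
  have h := pProd_linearIndependent (fun lam => c lam - ∑ S ∈ T.edgeFinset.powerset,
    if componentPartition (fromEdgeSet (S : Set (Sym2 V))) = lam then (-1 : ℤ) ^ S.card else 0) ?_
  · exact sub_eq_zero.1 (congrFun h lam)
  · simp only [sub_smul, Finset.sum_sub_distrib, Finset.sum_smul, ite_smul, zero_smul]
    rw [← finsum_eq_sum_of_fintype, ← hX, Finset.sum_comm, csf_eq_sum_pProd]
    simp

/-- with `d_{i,k} = Σ_{l(lam)=k+1} m_i(lam) c_lam(T)`, one has
`d_{i,k} = (-1)^((i-1)+(n-i-k)) Σ_{j=1}^{k} C(n-i-j, k-j) f_T(i,j)`. -/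
theorem stmt15 {V : Type*} [Fintype V] (T : SimpleGraph V)
    (hc : T.Connected) (ha : T.IsAcyclic)
    (n : Nat) (hn : Fintype.card V = n)
    (c : n.Partition → Int)
    (hX : csf T = ∑ᶠ lam : n.Partition, c lam • pProd lam.parts)
    (i k : Nat) (hi : 1 ≤ i) (hin : i ≤ n) (hk : 1 ≤ k) :
    (∑ᶠ lam ∈ {lam : n.Partition | lam.parts.card = k + 1},
        (lam.parts.count i : Int) * c lam) =
      (-1 : Int) ^ ((i - 1) + (n - i - k)) *
        ∑ j ∈ Finset.Icc 1 k, ((n - i - j).choose (k - j) : Int) * (fT T i j : Int) := by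
  classical
  subst hn
  rw [finsum_mem_eq_finite_toFinset_sum _ (Set.toFinite _)]
  have hf : ∀ j, (fT T i j : ℤ) = ∑ W : Set V with W.ncard = i ∧ (T.induce W).Connected,
      if Nat.card (T.induce Wᶜ).ConnectedComponent = j then 1 else 0 := by
    intro j
    rw [Finset.sum_boole, Finset.filter_filter, fT, Nat.card_coe_set_eq, ← Set.ncard_coe_finset]
    congr 2
    ext W
    simp [and_assoc]
  simp only [hf, coeff_eq_sum_of_csf_eq T c hX, Finset.mul_sum]
  rw [Finset.sum_comm]
  have hinner : ∀ S ∈ T.edgeFinset.powerset,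
      (∑ lam ∈ (Set.toFinite {lam : (Fintype.card V).Partition |
        lam.parts.card = k + 1}).toFinset, (lam.parts.count i : ℤ) *
        if componentPartition (fromEdgeSet (S : Set (Sym2 V))) = lam then (-1 : ℤ) ^ S.card else 0) =
      ∑ W : Set V with W.ncard = i ∧ (T.induce W).Connected,
        if S.card + (k + 1) = Fintype.card V ∧
          ∃ C : (fromEdgeSet (S : Set (Sym2 V))).ConnectedComponent, C.supp = W
        then (-1 : ℤ) ^ S.card else 0 := by
    intro S hS
    have hcard := card_parts_componentPartition ha hS
    simp only [mul_ite, mul_zero, Finset.sum_ite_eq, Set.Finite.mem_toFinset, Set.mem_ofPred_eq]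
    by_cases h : S.card + (k + 1) = Fintype.card V
    · rw [if_pos (by omega), count_componentPartition hS, Nat.cast_sum, Finset.sum_mul]
      simp [h]
    · rw [if_neg (by omega)]
      simp [h]
  rw [Finset.sum_congr rfl hinner, Finset.sum_comm,
    Finset.sum_comm (s := Finset.Icc 1 k)]
  refine Finset.sum_congr rfl fun W hW => ?_
  obtain ⟨-, rfl, hconn⟩ := Finset.mem_filter.1 hW
  rw [← Finset.sum_filter, ← Finset.mul_sum]
  exact sum_sign_of_component ha hconn hk
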